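/- Let G be a Cohen-Macaulay very well-covered graph with 2h vertices, labeled so that conditions (*) and (**) hold, and let w : E(G) → Z_{>0} be an edge weight such that the edge-weighted edge ideal I(G_w) is unmixed. Then for every k with 1 ≤ k ≤ h, the edge-weighted edge ideal I(O_k(G_w)) of the weighted graph O_k(G_w) is also unmixed. -/

import Mathlib

universe u

/-- An independent set in a graph. -/
def IsIndepSet {V : Type*} (G : SimpleGraph V) (A : Set V) : Prop :=
  A.Pairwise fun u v => ¬ G.Adj u v

/-- A maximal independent set in a graph. -/
def IsMaxIndepSet {V : Type*} (G : SimpleGraph V) (A : Set V) : Prop :=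
  IsIndepSet G A ∧ ∀ B, IsIndepSet G B → A ⊆ B → A = B

/-- A vertex cover of a graph. -/
def IsVertexCover {V : Type*} (G : SimpleGraph V) (C : Set V) : Prop :=
  ∀ ⦃u v⦄, G.Adj u v → u ∈ C ∨ v ∈ C

/-- A minimal vertex cover of a graph. -/
def IsMinVertexCover {V : Type*} (G : SimpleGraph V) (C : Set V) : Prop :=
  IsVertexCover G C ∧ ∀ B ⊆ C, IsVertexCover G B → B = C

/-- A graph has no isolated vertices. -/
def HasNoIsolatedVertices {V : Type*} (G : SimpleGraph V) : Prop :=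
  ∀ v, ∃ u, G.Adj v u

/-- A graph is very well-covered if it has no isolated vertices, an even number of
vertices, and every maximal independent set has cardinality half the number of vertices. -/
def IsVeryWellCovered {V : Type*} [Fintype V] (G : SimpleGraph V) : Prop :=
  HasNoIsolatedVertices G ∧ Even (Fintype.card V) ∧
    ∀ A : Set V, IsMaxIndepSet G A → A.ncard = Fintype.card V / 2

/-- Condition (*) for a graph on the `2h` vertices `x_1, …, x_h, y_1, …, y_h`
(encoded as `Sum.inl 0, …, Sum.inl (h-1), Sum.inr 0, …, Sum.inr (h-1)`):
`X = {x_1, …, x_h}` is a minimal vertex cover, `Y = {y_1, …, y_h}` is a maximal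
independent set, and `x_i y_i` is an edge for every `i`. -/
def CondStar {h : ℕ} (G : SimpleGraph (Fin h ⊕ Fin h)) : Prop :=
  IsMinVertexCover G (Set.range Sum.inl) ∧
    IsMaxIndepSet G (Set.range Sum.inr) ∧
    ∀ i : Fin h, G.Adj (Sum.inl i) (Sum.inr i)

/-- The height of an ideal `p` (intended: a prime ideal), i.e. the Krull dimension of the
set of prime ideals contained in `p`. -/
noncomputable def idealHeight {R : Type*} [CommRing R] (p : Ideal R) : WithBot ℕ∞ :=
  Order.krullDim {q : PrimeSpectrum R // q.asIdeal ≤ p}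

/-- An ideal `I ⊆ R` is unmixed if all associated primes of `R ⧸ I` have the same height. -/
def IsUnmixedIdeal {R : Type*} [CommRing R] (I : Ideal R) : Prop :=
  ∀ p ∈ associatedPrimes R (R ⧸ I), ∀ q ∈ associatedPrimes R (R ⧸ I),
    idealHeight p = idealHeight q

/-- The monomial associated to a weighted edge: `(X u * X v) ^ w(e)` for `e = uv`. -/
noncomputable def edgeMonomial {V : Type*} (K : Type*) [CommSemiring K]
    (w : Sym2 V → ℕ) (e : Sym2 V) : MvPolynomial V K :=
  (Sym2.lift ⟨fun u v => MvPolynomial.X u * MvPolynomial.X v,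
    fun u v => mul_comm _ _⟩ e) ^ w e

/-- The edge-weighted edge ideal `I(G_w)` of an edge-weighted graph `G_w`. -/
noncomputable def weightedEdgeIdeal {V : Type*} (K : Type*) [CommSemiring K]
    (G : SimpleGraph V) (w : Sym2 V → ℕ) : Ideal (MvPolynomial V K) :=
  Ideal.span (edgeMonomial K w '' G.edgeSet)

open CategoryTheory in
/-- The Ext module `Ext_R^n(M, N)`. -/
noncomputable def ExtMod (R : Type u) [CommRing R] (n : ℕ) (M N : Type u)
    [AddCommGroup M] [Module R M] [AddCommGroup N] [Module R N] : ModuleCat R :=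
  ((Ext R (ModuleCat R) n).obj (Opposite.op (ModuleCat.of R M))).obj (ModuleCat.of R N)

/-- The depth of a local ring `R`, defined via vanishing of the Ext modules
`Ext_R^n(k, R)`, where `k` is the residue field of `R`. -/
noncomputable def localRingDepth (R : Type u) [CommRing R] [IsLocalRing R] : ℕ∞ :=
  sInf {n : ℕ∞ | ∃ m : ℕ, n = m ∧
    Nontrivial (ExtMod R m (IsLocalRing.ResidueField R) R)}

/-- A commutative ring is Cohen-Macaulay if for every maximal ideal `p`, the depth of the
localization at `p` equals its Krull dimension. -/
def IsCohenMacaulayRing (R : Type u) [CommRing R] : Prop :=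
  ∀ (p : Ideal R) [p.IsMaximal],
    (localRingDepth (Localization.AtPrime p) : WithBot ℕ∞) =
      ringKrullDim (Localization.AtPrime p)

/-- The (unweighted) edge ideal `I(G)` of a graph, generated by the monomials `X u * X v`
for the edges `uv` of `G`. -/
noncomputable def edgeIdeal {V : Type*} (K : Type*) [CommSemiring K]
    (G : SimpleGraph V) : Ideal (MvPolynomial V K) :=
  Ideal.span ((fun e => Sym2.lift ⟨fun u v => MvPolynomial.X u * MvPolynomial.X v,
    fun u v => mul_comm _ _⟩ e) '' G.edgeSet)

/-- The set `N_i = {k : x_k y_i ∈ E(G)} \ {i}`. -/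
def Nset {h : ℕ} (G : SimpleGraph (Fin h ⊕ Fin h)) (i : Fin h) : Set (Fin h) :=
  {k | G.Adj (Sum.inl k) (Sum.inr i) ∧ k ≠ i}

/-- The base graph `O_i(G) = G - {x_k y_i : k ∈ N_i} + {x_k x_i : k ∈ N_i}`. -/
def Ograph {h : ℕ} (G : SimpleGraph (Fin h ⊕ Fin h)) (i : Fin h) :
    SimpleGraph (Fin h ⊕ Fin h) :=
  SimpleGraph.fromEdgeSet
    ((G.edgeSet \ {e | ∃ k ∈ Nset G i, e = s(Sum.inl k, Sum.inr i)}) ∪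
      {e | ∃ k ∈ Nset G i, e = s(Sum.inl k, Sum.inl i)})

open scoped Classical in
/-- The weight `w'` on `O_i(G)`: `w'(x_k x_i) = w(x_k y_i)` for `k ∈ N_i`, and `w' = w`
on all other edges. -/
noncomputable def Oweight {h : ℕ} (G : SimpleGraph (Fin h ⊕ Fin h))
    (w : Sym2 (Fin h ⊕ Fin h) → ℕ) (i : Fin h) : Sym2 (Fin h ⊕ Fin h) → ℕ :=
  fun e =>
    if hk : ∃ k ∈ Nset G i, e = s(Sum.inl k, Sum.inl i) then
      w s(Sum.inl hk.choose, Sum.inr i)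
    else w e

section MonomialIdeals

open MvPolynomial

/-- If `g * f` lies in the monomial ideal `(X v ^ δ v : δ v < ⊤)` and `f` does not, then `g` lies
in the radical `(X v : δ v < ⊤)` of that ideal. -/
lemma mem_span_X_of_mul_of_notMem {V K : Type*} [Fintype V] [Field K] {δ : V → ℕ∞}
    {f g : MvPolynomial V K} (hgf : ∀ m ∈ (g * f).support, ∃ v, δ v ≤ (m v : ℕ∞))
    (hf : ∃ n ∈ f.support, ∀ v, (n v : ℕ∞) < δ v) :
    g ∈ Ideal.span (X '' {v | δ v ≠ ⊤} : Set (MvPolynomial V K)) := by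
  classical
  rw [mem_ideal_span_X_image]
  by_contra! hg
  obtain ⟨m₀, hm₀, hm₀C⟩ := hg
  obtain ⟨n₀, hn₀, hn₀δ⟩ := hf
  let deg : (V →₀ ℕ) → ℕ := fun n => ∑ v with δ v ≠ ⊤, n v
  let B := f.support.filter fun n => ∀ v, (n v : ℕ∞) < δ v
  obtain ⟨n₁, hn₁B, hmin⟩ := B.exists_min_image deg ⟨n₀, by simp [B, hn₀δ]; simpa using hn₀⟩
  let A := g.support.filter fun m => ∀ v, δ v ≠ ⊤ → m v = 0
  obtain ⟨a, ha, b, hb, hab⟩ := UniqueSums.uniqueAdd_of_nonempty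
    (A := A) (B := B.filter fun n => deg n = deg n₁)
    ⟨m₀, Finset.mem_filter.2 ⟨hm₀, hm₀C⟩⟩ ⟨n₁, Finset.mem_filter.2 ⟨hn₁B, rfl⟩⟩
  obtain ⟨hag, haC⟩ := Finset.mem_filter.1 ha
  obtain ⟨hbB, hbdeg⟩ := Finset.mem_filter.1 hb
  obtain ⟨hbf, hbδ⟩ := Finset.mem_filter.1 hbB
  have hcoeff : coeff (a + b) (g * f) = coeff a g * coeff b f := by
    rw [coeff_mul]
    refine Finset.sum_eq_single (a, b) ?_ (by simp)
    rintro ⟨p, q⟩ hpq hne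
    rw [Finset.HasAntidiagonal.mem_antidiagonal] at hpq
    by_contra hpq0
    have hp : p ∈ g.support := mem_support_iff.2 (left_ne_zero_of_mul hpq0)
    have hq : q ∈ f.support := mem_support_iff.2 (right_ne_zero_of_mul hpq0)
    have hsum : ∀ v, p v + q v = a v + b v := fun v => by simpa using DFunLike.congr_fun hpq v
    have hqb : ∀ v, δ v ≠ ⊤ → q v ≤ b v := fun v hv => by
      have := hsum v
      have := haC v hv
      omega
    have hqB : q ∈ B := Finset.mem_filter.2 ⟨hq, fun v => by
      by_cases hv : δ v = ⊤
      · simp [hv]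
      · exact lt_of_le_of_lt (by exact_mod_cast hqb v hv) (hbδ v)⟩
    have hle : deg q ≤ deg b :=
      Finset.sum_le_sum fun v hv => hqb v (Finset.mem_filter.1 hv).2
    have hdeg : deg q = deg n₁ := le_antisymm (hle.trans hbdeg.le) (hmin q hqB)
    have heq : ∀ v, δ v ≠ ⊤ → q v = b v := fun v hv =>
      (Finset.sum_eq_sum_iff_of_le fun v hv => hqb v (Finset.mem_filter.1 hv).2).1
        (hdeg.trans hbdeg.symm) v (by simpa using hv)
    have hpA : p ∈ A := Finset.mem_filter.2 ⟨hp, fun v hv => by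
      have := hsum v
      have := haC v hv
      have := heq v hv
      omega⟩
    have := hab hpA (Finset.mem_filter.2 ⟨hqB, hdeg⟩) hpq
    exact hne (Prod.ext this.1 this.2)
  obtain ⟨v, hv⟩ := hgf (a + b) (by
    rw [mem_support_iff, hcoeff]
    exact mul_ne_zero (mem_support_iff.1 hag) (mem_support_iff.1 hbf))
  have hvb := hbδ v
  have hav := haC v (ne_top_of_le_ne_top (ENat.natCast_ne_top _) hv)
  rw [Finsupp.add_apply, hav, zero_add] at hv
  exact hv.not_gt hvb

/-- An ideal generated by variables is prime. -/
lemma isPrime_span_X_image {V K : Type*} [Fintype V] [Field K] (C : Set V) :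
    (Ideal.span (X '' C : Set (MvPolynomial V K))).IsPrime := by
  classical
  refine ⟨fun h => ?_, fun {g f} hgf => or_iff_not_imp_right.2 fun hf => ?_⟩
  · have h1 := (Ideal.eq_top_iff_one _).1 h
    rw [mem_ideal_span_X_image] at h1
    obtain ⟨i, -, hi⟩ := h1 0 (by simp)
    exact hi rfl
  · let δ : V → ℕ∞ := fun v => if v ∈ C then 1 else ⊤
    have hC : {v | δ v ≠ ⊤} = C := by
      ext v
      by_cases hv : v ∈ C <;> simp [δ, hv]
    rw [← hC]
    refine mem_span_X_of_mul_of_notMem (f := f) (fun m hm => ?_) ?_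
    · obtain ⟨v, hv, hmv⟩ := mem_ideal_span_X_image.1 hgf m hm
      exact ⟨v, by simpa [δ, hv, Order.one_le_iff_pos, Nat.pos_iff_ne_zero] using hmv⟩
    · rw [mem_ideal_span_X_image] at hf
      push Not at hf
      obtain ⟨n, hn, hnC⟩ := hf
      refine ⟨n, hn, fun v => ?_⟩
      by_cases hv : v ∈ C <;> simp [δ, hv, hnC v]

lemma X_mem_span_X_image {V K : Type*} [Field K] {C : Set V} {v : V} :
    (X v : MvPolynomial V K) ∈ Ideal.span (X '' C : Set (MvPolynomial V K)) ↔ v ∈ C := by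
  classical
  rw [mem_ideal_span_X_image, support_X]
  simp [Finsupp.single_apply]

/-- The height of an ideal generated by variables is the number of those variables. -/
lemma height_span_X_image {V K : Type*} [Fintype V] [Field K] (C : Finset V) :
    (Ideal.span (X '' (C : Set V) : Set (MvPolynomial V K))).height = C.card := by
  classical
  refine le_antisymm ?_ ?_
  · have := isPrime_span_X_image (K := K) (C : Set V)
    refine (Ideal.height_le_card_of_mem_minimalPrimes_span (C.finite_toSet.image X) ?_).trans ?_
    · rw [Ideal.minimalPrimes_eq_subsingleton_self]
      rfl
    · rw [Set.ncard_image_of_injective _ X_injective, Set.ncard_coe_finset]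
  · induction C using Finset.induction_on with
    | empty => simp
    | insert c C hc ih =>
      have h1 := isPrime_span_X_image (K := K) (C : Set V)
      have h2 := isPrime_span_X_image (K := K) ((insert c C : Finset V) : Set V)
      have hlt : Ideal.span (X '' (C : Set V) : Set (MvPolynomial V K)) <
          Ideal.span (X '' ((insert c C : Finset V) : Set V)) := by
        refine lt_of_le_of_ne (Ideal.span_mono (Set.image_mono (by simp))) fun h => hc ?_
        have : (X c : MvPolynomial V K) ∈ Ideal.span (X '' ((insert c C : Finset V) : Set V)) :=
          X_mem_span_X_image.2 (by simp)
        rw [← h] at this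
        exact_mod_cast X_mem_span_X_image.1 this
      rw [Finset.card_insert_of_notMem hc, Nat.cast_add, Nat.cast_one]
      exact (add_le_add_left ih 1).trans
        (Order.add_one_le_of_lt (Ideal.height_strict_mono_of_isPrime_of_isPrime hlt))

lemma idealHeight_eq_height {R : Type*} [CommRing R] (p : Ideal R) [hp : p.IsPrime] :
    idealHeight p = p.height := by
  have := PrimeSpectrum.height_eq_orderHeight (⟨p, hp⟩ : PrimeSpectrum R)
  rw [show p.height = Order.height (⟨p, hp⟩ : PrimeSpectrum R) from this,
    Order.height_eq_krullDim_Iic]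
  rfl

lemma idealHeight_span_X_image {V K : Type*} [Fintype V] [Field K] (C : Set V) :
    idealHeight (Ideal.span (X '' C : Set (MvPolynomial V K))) =
      ((C.ncard : ℕ∞) : WithBot ℕ∞) := by
  classical
  have := isPrime_span_X_image (K := K) C
  have h := height_span_X_image (K := K) C.toFinite.toFinset
  rw [Set.Finite.coe_toFinset] at h
  rw [idealHeight_eq_height, h, Set.ncard_eq_toFinset_card C]

end MonomialIdeals

section WeightedCovers

open MvPolynomial

variable {V : Type*}

/-- Exponents `δ` such that the ideal `(X v ^ δ v : δ v < ⊤)` contains the edge-weighted edge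
ideal. -/
def IsWeightedCover (G : SimpleGraph V) (w : Sym2 V → ℕ) (δ : V → ℕ∞) : Prop :=
  ∀ ⦃u v⦄, G.Adj u v → δ u ≤ w s(u, v) ∨ δ v ≤ w s(u, v)

/-- Every finite exponent of `δ` is forced by some edge. -/
def IsTight (G : SimpleGraph V) (w : Sym2 V → ℕ) (δ : V → ℕ∞) : Prop :=
  ∀ ⦃v⦄, δ v ≠ ⊤ → ∃ z, G.Adj v z ∧ δ v = w s(v, z) ∧ δ v < δ z

lemma IsWeightedCover.exists_isTight {G : SimpleGraph V} {w : Sym2 V → ℕ} {δ₀ : V → ℕ∞}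
    (h₀ : IsWeightedCover G w δ₀) : ∃ δ, δ₀ ≤ δ ∧ IsWeightedCover G w δ ∧ IsTight G w δ := by
  classical
  obtain ⟨δ, hle, hmax⟩ := zorn_le_nonempty₀ {δ | IsWeightedCover G w δ}
    (fun c hc hchain _ _ => ⟨sSup c, fun u v huv => by
      by_contra! hcon
      simp only [sSup_apply, lt_iSup_iff] at hcon
      obtain ⟨⟨⟨δ₁, h₁⟩, hu⟩, ⟨δ₂, h₂⟩, hv⟩ := hcon
      rcases hchain.total h₁ h₂ with h | h
      · exact (hc h₂ huv).elim (fun h' => (hu.trans_le (h u)).not_ge h') hv.not_ge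
      · exact (hc h₁ huv).elim hu.not_ge (fun h' => (hv.trans_le (h v)).not_ge h'),
      fun δ hδ => le_sSup hδ⟩) δ₀ h₀
  have hcov : IsWeightedCover G w δ := hmax.prop
  refine ⟨δ, hle, hcov, fun v hv => ?_⟩
  by_contra! hcon
  have hlt : δ v < δ v + 1 := ENat.lt_add_one_iff hv |>.2 le_rfl
  have key : ∀ ⦃z⦄, G.Adj v z → δ v + 1 ≤ w s(v, z) ∨ δ z ≤ w s(v, z) := fun z hz => by
    rcases hcov hz with h | h
    · rcases h.lt_or_eq with h | h
      · exact Or.inl (Order.add_one_le_of_lt h)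
      · exact Or.inr ((hcon z hz h).trans h.le)
    · exact Or.inr h
  have hupd : IsWeightedCover G w (Function.update δ v (δ v + 1)) := fun a b hab => by
    have hne := hab.ne
    by_cases ha : a = v
    · subst ha
      simpa [Function.update_of_ne hne.symm] using key hab
    · by_cases hb : b = v
      · subst hb
        simpa [Function.update_of_ne hne, Sym2.eq_swap, or_comm] using key hab.symm
      · simpa [Function.update_of_ne ha, Function.update_of_ne hb] using hcov hab
  have hle' : δ ≤ Function.update δ v (δ v + 1) :=
    le_update_iff.2 ⟨hlt.le, fun _ _ => le_rfl⟩
  have := hmax.le_of_ge hupd hle' v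
  rw [Function.update_self] at this
  exact hlt.not_ge this

variable {K : Type*} [Field K] {G : SimpleGraph V} {w : Sym2 V → ℕ}

lemma edgeMonomial_mk (u v : V) :
    edgeMonomial K w s(u, v) = (X u * X v) ^ w s(u, v) := rfl

/-- A polynomial lies in the edge-weighted edge ideal iff each of its monomials is divisible by
the monomial of some weighted edge. -/
lemma mem_weightedEdgeIdeal_iff {f : MvPolynomial V K} :
    f ∈ weightedEdgeIdeal K G w ↔
      ∀ m ∈ f.support, ∃ u v, G.Adj u v ∧ w s(u, v) ≤ m u ∧ w s(u, v) ≤ m v := by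
  classical
  have himage : edgeMonomial K w '' G.edgeSet = (fun s => monomial s (1 : K)) ''
      {s | ∃ u v, G.Adj u v ∧
        s = Finsupp.single u (w s(u, v)) + Finsupp.single v (w s(u, v))} := by
    have hmon (u v : V) : edgeMonomial K w s(u, v) = monomial
        (Finsupp.single u (w s(u, v)) + Finsupp.single v (w s(u, v))) 1 := by
      rw [edgeMonomial_mk, mul_pow, X_pow_eq_monomial, X_pow_eq_monomial, monomial_mul, mul_one]
    ext f
    constructor
    · rintro ⟨e, he, rfl⟩
      induction e using Sym2.ind with
      | _ u v => exact ⟨_, ⟨u, v, he, rfl⟩, (hmon u v).symm⟩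
    · rintro ⟨_, ⟨u, v, huv, rfl⟩, rfl⟩
      exact ⟨s(u, v), huv, hmon u v⟩
  rw [weightedEdgeIdeal, himage, mem_ideal_span_monomial_image]
  refine forall₂_congr fun m _ => ⟨?_, ?_⟩
  · rintro ⟨_, ⟨u, v, huv, rfl⟩, hle⟩
    refine ⟨u, v, huv, (le_trans ?_ (hle u)), (le_trans ?_ (hle v))⟩ <;> simp
  · rintro ⟨u, v, huv, hu, hv⟩
    refine ⟨_, ⟨u, v, huv, rfl⟩, fun x => ?_⟩
    by_cases hxu : u = x
    · subst hxu
      simpa [Finsupp.single_apply, huv.ne.symm] using hu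
    · by_cases hxv : v = x
      · subst hxv
        simpa [Finsupp.single_apply, huv.ne] using hv
      · simp [hxu, hxv]

lemma IsWeightedCover.exists_le_of_mem {δ : V → ℕ∞} (hδ : IsWeightedCover G w δ)
    {f : MvPolynomial V K} (hf : f ∈ weightedEdgeIdeal K G w) :
    ∀ m ∈ f.support, ∃ v, δ v ≤ (m v : ℕ∞) := fun m hm => by
  obtain ⟨u, v, huv, hu, hv⟩ := mem_weightedEdgeIdeal_iff.1 hf m hm
  rcases hδ huv with h | h
  · exact ⟨u, h.trans (by exact_mod_cast hu)⟩
  · exact ⟨v, h.trans (by exact_mod_cast hv)⟩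

lemma mem_associatedPrimes_quotient_iff {R : Type*} [CommRing R] [IsNoetherianRing R]
    {I p : Ideal R} :
    p ∈ associatedPrimes R (R ⧸ I) ↔ p.IsPrime ∧ ∃ f, ∀ g, g ∈ p ↔ g * f ∈ I := by
  have hmem (f g : R) : g • (Ideal.Quotient.mk I f) ∈ (⊥ : Submodule R (R ⧸ I)) ↔ g * f ∈ I := by
    rw [Submodule.mem_bot, ← Ideal.Quotient.eq_zero_iff_mem, map_mul]
    rfl
  change IsAssociatedPrime p (R ⧸ I) ↔ _
  rw [isAssociatedPrime_iff]
  refine and_congr_right fun _ => ⟨?_, ?_⟩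
  · rintro ⟨x, hx⟩
    obtain ⟨f, rfl⟩ := Ideal.Quotient.mk_surjective x
    exact ⟨f, fun g => by rw [hx, Submodule.mem_colon_singleton, hmem]⟩
  · rintro ⟨f, hf⟩
    exact ⟨Ideal.Quotient.mk I f, Ideal.ext fun g => by
      rw [hf, Submodule.mem_colon_singleton, hmem]⟩

/-- The support of a tight weighted cover generates an associated prime. -/
lemma IsTight.span_X_image_mem_associatedPrimes [Fintype V] (hw : ∀ e ∈ G.edgeSet, 0 < w e)
    {δ : V → ℕ∞} (hδ : IsWeightedCover G w δ) (ht : IsTight G w δ) :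
    Ideal.span (X '' {v | δ v ≠ ⊤} : Set (MvPolynomial V K)) ∈
      associatedPrimes (MvPolynomial V K) (MvPolynomial V K ⧸ weightedEdgeIdeal K G w) := by
  classical
  rw [mem_associatedPrimes_quotient_iff]
  refine ⟨isPrime_span_X_image _, ?_⟩
  obtain ⟨N, hN⟩ : ∃ N, ∀ u v, w s(u, v) ≤ N :=
    ⟨Finset.univ.sup w, fun u v => Finset.le_sup (Finset.mem_univ _)⟩
  let m : V →₀ ℕ := Finsupp.equivFunOnFinite.symm fun v =>
    if δ v = ⊤ then N else (δ v).toNat - 1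
  have hmtop : ∀ v, δ v = ⊤ → m v = N := fun v hv => by simp [m, hv]
  have hmfin : ∀ v (n : ℕ), δ v = n → m v = n - 1 := fun v n hv => by simp [m, hv]
  refine ⟨monomial m 1, fun g => ⟨?_, fun hg => ?_⟩⟩
  · suffices Ideal.span (X '' {v | δ v ≠ ⊤} : Set (MvPolynomial V K)) ≤
        (weightedEdgeIdeal K G w).colon {monomial m (1 : K)} from
      fun hg => Submodule.mem_colon_singleton.1 (this hg)
    rw [Ideal.span_le]
    rintro _ ⟨v, hv, rfl⟩
    refine Submodule.mem_colon_singleton.2 ?_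
    obtain ⟨z, hz, hvz, hlt⟩ := ht hv
    rw [smul_eq_mul, ← pow_one (X v : MvPolynomial V K), X_pow_eq_monomial, monomial_mul, mul_one,
      mem_weightedEdgeIdeal_iff]
    intro n hn
    rw [support_monomial, if_neg one_ne_zero, Finset.mem_singleton] at hn
    subst hn
    refine ⟨v, z, hz, ?_, ?_⟩
    · have := hmfin v _ hvz
      simp only [Finsupp.add_apply, Finsupp.single_eq_same]
      omega
    · refine le_trans ?_ (Nat.le_add_left _ _)
      by_cases hz' : δ z = ⊤
      · exact hmtop z hz' ▸ hN v z
      · obtain ⟨n, hn⟩ := ENat.ne_top_iff_exists.1 hz'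
        rw [hmfin z n hn.symm]
        rw [hvz, ← hn] at hlt
        have : w s(v, z) < n := by exact_mod_cast hlt
        omega
  · refine mem_span_X_of_mul_of_notMem (hδ.exists_le_of_mem hg) ⟨m, by simp, fun v => ?_⟩
    by_cases hv : δ v = ⊤
    · simp [hv]
    · obtain ⟨z, hz, hvz, -⟩ := ht hv
      have hpos := hw s(v, z) hz
      rw [hmfin v _ hvz, hvz]
      exact_mod_cast Nat.sub_lt hpos one_pos

/-- Every associated prime of an edge-weighted edge ideal is contained in the prime generated by
the support of a tight weighted cover. -/
lemma exists_isTight_le_of_mem_associatedPrimes [Fintype V] {p : Ideal (MvPolynomial V K)}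
    (hp : p ∈ associatedPrimes (MvPolynomial V K) (MvPolynomial V K ⧸ weightedEdgeIdeal K G w)) :
    ∃ δ, IsWeightedCover G w δ ∧ IsTight G w δ ∧ p ≤ Ideal.span (X '' {v | δ v ≠ ⊤}) := by
  classical
  obtain ⟨hprime, f, hf⟩ := mem_associatedPrimes_quotient_iff.1 hp
  have hfI : f ∉ weightedEdgeIdeal K G w := fun h =>
    hprime.ne_top ((Ideal.eq_top_iff_one p).2 ((hf 1).2 (by rwa [one_mul])))
  rw [mem_weightedEdgeIdeal_iff] at hfI
  push Not at hfI
  obtain ⟨m, hm, hmw⟩ := hfI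
  have hcov : IsWeightedCover G w fun v => ((m v + 1 : ℕ) : ℕ∞) := fun u v huv => by
    by_cases h : w s(u, v) ≤ m u
    · exact Or.inr (Nat.cast_le.2 (hmw u v huv h))
    · exact Or.inl (Nat.cast_le.2 (not_le.1 h))
  obtain ⟨δ, hle, hδ, ht⟩ := hcov.exists_isTight
  refine ⟨δ, hδ, ht, fun g hg => ?_⟩
  exact mem_span_X_of_mul_of_notMem (hδ.exists_le_of_mem ((hf g).1 hg))
    ⟨m, hm, fun v => lt_of_lt_of_le (Nat.cast_lt.2 (Nat.lt_succ_self _)) (hle v)⟩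

end WeightedCovers

section PerfectMatching

open MvPolynomial

variable {h : ℕ} {G : SimpleGraph (Fin h ⊕ Fin h)} {w : Sym2 (Fin h ⊕ Fin h) → ℕ}

/-- Neighbours of matched vertices `x_i` and `y_i` are adjacent, by an edge whose weight is at most
the weights of the edges joining them to `x_i` and `y_i`. -/
def WeightedExchange (G : SimpleGraph (Fin h ⊕ Fin h)) (w : Sym2 (Fin h ⊕ Fin h) → ℕ) : Prop :=
  ∀ ⦃i z z'⦄, G.Adj (Sum.inl i) z → G.Adj (Sum.inr i) z' →
    G.Adj z z' ∧ w s(z, z') ≤ w s(Sum.inl i, z) ∧ w s(z, z') ≤ w s(Sum.inr i, z')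

lemma IsWeightedCover.image_elim_eq_univ (hmatch : ∀ i, G.Adj (Sum.inl i) (Sum.inr i))
    {δ : Fin h ⊕ Fin h → ℕ∞} (hδ : IsWeightedCover G w δ) :
    Sum.elim id id '' {v | δ v ≠ ⊤} = (Set.univ : Set (Fin h)) := by
  refine Set.eq_univ_of_forall fun i => ?_
  rcases hδ (hmatch i) with hi | hi
  · exact ⟨Sum.inl i, ne_top_of_le_ne_top (ENat.natCast_ne_top _) hi, rfl⟩
  · exact ⟨Sum.inr i, ne_top_of_le_ne_top (ENat.natCast_ne_top _) hi, rfl⟩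

/-- If the edge-weighted edge ideal is unmixed, then no weighted cover leaves room on a neighbour
of `x_i` and on a neighbour of `y_i`. -/
lemma IsWeightedCover.false_of_isUnmixedIdeal {K : Type*} [Field K]
    (hindep : IsIndepSet G (Set.range Sum.inr)) (hmatch : ∀ i, G.Adj (Sum.inl i) (Sum.inr i))
    (hw : ∀ e ∈ G.edgeSet, 0 < w e) (hunm : IsUnmixedIdeal (weightedEdgeIdeal K G w))
    {δ₀ : Fin h ⊕ Fin h → ℕ∞} (hδ₀ : IsWeightedCover G w δ₀) {i : Fin h} {z z' : Fin h ⊕ Fin h}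
    (hz : G.Adj (Sum.inl i) z) (hz' : G.Adj (Sum.inr i) z') (hlt : w s(Sum.inl i, z) < δ₀ z)
    (hlt' : w s(Sum.inr i, z') < δ₀ z') : False := by
  obtain ⟨δ, hle, hδ, ht⟩ := hδ₀.exists_isTight
  have hcovY : IsWeightedCover G w (Sum.elim (fun _ => 0) fun _ => ⊤) := by
    rintro (u | u) (v | v) huv
    · simp
    · simp
    · simp
    · exact (hindep ⟨u, rfl⟩ ⟨v, rfl⟩ huv.ne huv).elim
  obtain ⟨ε, hleY, hε, htY⟩ := hcovY.exists_isTight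
  have hcard := hunm _ (ht.span_X_image_mem_associatedPrimes (K := K) hw hδ) _
    (htY.span_X_image_mem_associatedPrimes (K := K) hw hε)
  rw [idealHeight_span_X_image, idealHeight_span_X_image] at hcard
  have hcard' : {v | δ v ≠ ⊤}.ncard = {v | ε v ≠ ⊤}.ncard := by exact_mod_cast hcard
  have hεle : {v | ε v ≠ ⊤} ⊆ Set.range Sum.inl := by
    rintro (v | v) hv
    · exact ⟨v, rfl⟩
    · exact (hv (top_le_iff.1 (hleY (Sum.inr v)))).elim
  have hinj : Set.InjOn (Sum.elim id id) {v | δ v ≠ ⊤} := by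
    refine Set.injOn_of_ncard_image_eq (le_antisymm Set.ncard_image_le ?_)
    rw [hδ.image_elim_eq_univ hmatch, hcard', Set.ncard_univ, Nat.card_fin]
    refine (Set.ncard_le_ncard hεle).trans ?_
    rw [← Set.image_univ, Set.ncard_image_of_injective _ Sum.inl_injective, Set.ncard_univ,
      Nat.card_fin]
  have hx : δ (Sum.inl i) ≠ ⊤ := ne_top_of_le_ne_top (ENat.natCast_ne_top _)
    ((hδ hz).resolve_right (hlt.trans_le (hle z)).not_ge)
  have hy : δ (Sum.inr i) ≠ ⊤ := ne_top_of_le_ne_top (ENat.natCast_ne_top _)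
    ((hδ hz').resolve_right (hlt'.trans_le (hle z')).not_ge)
  exact Sum.inl_ne_inr (hinj hx hy rfl)

lemma weightedExchange_of_isUnmixedIdeal {K : Type*} [Field K]
    (hindep : IsIndepSet G (Set.range Sum.inr)) (hmatch : ∀ i, G.Adj (Sum.inl i) (Sum.inr i))
    (hw : ∀ e ∈ G.edgeSet, 0 < w e) (hunm : IsUnmixedIdeal (weightedEdgeIdeal K G w)) :
    WeightedExchange G w := by
  classical
  intro i z z' hz hz'
  by_contra hcon
  let δ : Fin h ⊕ Fin h → ℕ := fun v =>
    max (if v = z then w s(Sum.inl i, z) + 1 else 0) (if v = z' then w s(Sum.inr i, z') + 1 else 0)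
  have hδz : w s(Sum.inl i, z) < δ z := by simp [δ]
  have hδz' : w s(Sum.inr i, z') < δ z' := by simp [δ]
  have hzero : ∀ v, v ≠ z → v ≠ z' → δ v = 0 := fun v h₁ h₂ => by simp [δ, h₁, h₂]
  have hedge : G.Adj z z' → δ z ≤ w s(z, z') ∨ δ z' ≤ w s(z, z') := fun hadj => by
    have hne := hadj.ne
    have h₁ : δ z = w s(Sum.inl i, z) + 1 := by simp [δ, hne]
    have h₂ : δ z' = w s(Sum.inr i, z') + 1 := by simp [δ, hne.symm]
    by_contra! hlt
    exact hcon ⟨hadj, by omega, by omega⟩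
  have hcov : IsWeightedCover G w fun v => (δ v : ℕ∞) := fun u v huv => by
    simp only [Nat.cast_le]
    by_cases hu : u = z ∨ u = z'
    · by_cases hv : v = z ∨ v = z'
      · rcases hu with rfl | rfl <;> rcases hv with rfl | rfl
        · exact (huv.ne rfl).elim
        · exact hedge huv
        · rw [Sym2.eq_swap, or_comm]
          exact hedge huv.symm
        · exact (huv.ne rfl).elim
      · push Not at hv
        simp [hzero v hv.1 hv.2]
    · push Not at hu
      simp [hzero u hu.1 hu.2]
  exact hcov.false_of_isUnmixedIdeal hindep hmatch hw hunm hz hz' (Nat.cast_lt.2 hδz)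
    (Nat.cast_lt.2 hδz')

lemma WeightedExchange.isUnmixedIdeal {K : Type*} [Field K]
    (hmatch : ∀ i, G.Adj (Sum.inl i) (Sum.inr i)) (hex : WeightedExchange G w) :
    IsUnmixedIdeal (weightedEdgeIdeal K G w) := by
  suffices ∀ p ∈ associatedPrimes _ (_ ⧸ weightedEdgeIdeal K G w), idealHeight p = (h : ℕ∞) from
    fun p hp q hq => (this p hp).trans (this q hq).symm
  intro p hp
  obtain ⟨δ, hδ, ht, hle⟩ := exists_isTight_le_of_mem_associatedPrimes hp
  obtain ⟨hprime, f, hf⟩ := mem_associatedPrimes_quotient_iff.1 hp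
  have hnot : ∀ i, δ (Sum.inl i) ≠ ⊤ → δ (Sum.inr i) ≠ ⊤ → False := fun i hx hy => by
    obtain ⟨z, hz, hxz, hlt⟩ := ht hx
    obtain ⟨z', hz', hyz, hlt'⟩ := ht hy
    obtain ⟨hadj, h₁, h₂⟩ := hex hz hz'
    rcases hδ hadj with h | h
    · exact (hlt.trans_le h).not_ge (hxz ▸ Nat.cast_le.2 h₁)
    · exact (hlt'.trans_le h).not_ge (hyz ▸ Nat.cast_le.2 h₂)
  have hmem : ∀ i, (X (Sum.inl i) : MvPolynomial (Fin h ⊕ Fin h) K) ∈ p ∨ X (Sum.inr i) ∈ p :=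
    fun i => hprime.mem_or_mem (hprime.mem_of_pow_mem _ ((hf _).2
      (Ideal.mul_mem_right _ _ (Ideal.subset_span ⟨s(Sum.inl i, Sum.inr i), hmatch i, rfl⟩))))
  have hge : Ideal.span (X '' {v | δ v ≠ ⊤}) ≤ p := by
    rw [Ideal.span_le]
    rintro _ ⟨v | v, hv, rfl⟩
    · exact (hmem v).resolve_right fun h' =>
        hnot v hv (X_mem_span_X_image.1 (hle h'))
    · exact (hmem v).resolve_left fun h' =>
        hnot v (X_mem_span_X_image.1 (hle h')) hv
  have hinj : Set.InjOn (Sum.elim id id) {v | δ v ≠ ⊤} := by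
    rintro (u | u) hu (v | v) hv (rfl : u = v)
    · rfl
    · exact (hnot u hu hv).elim
    · exact (hnot u hv hu).elim
    · rfl
  rw [le_antisymm hle hge, idealHeight_span_X_image, ← hinj.ncard_image,
    hδ.image_elim_eq_univ hmatch, Set.ncard_univ, Nat.card_fin]

end PerfectMatching

section Ograph

variable {h : ℕ} {G : SimpleGraph (Fin h ⊕ Fin h)} {w : Sym2 (Fin h ⊕ Fin h) → ℕ} {k : Fin h}

lemma Ograph_adj_iff {u v : Fin h ⊕ Fin h} :
    (Ograph G k).Adj u v ↔
      ((G.Adj u v ∧ ∀ j ∈ Nset G k, s(u, v) ≠ s(Sum.inl j, Sum.inr k)) ∨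
        ∃ j ∈ Nset G k, s(u, v) = s(Sum.inl j, Sum.inl k)) ∧ u ≠ v := by
  simp only [Ograph, SimpleGraph.fromEdgeSet_adj, Set.mem_union, Set.mem_sdiff, Set.mem_ofPred_eq,
    SimpleGraph.mem_edgeSet, not_exists, not_and, ne_eq]

lemma Ograph_adj_of_adj {u v : Fin h ⊕ Fin h} (huv : G.Adj u v)
    (hne : ∀ j ∈ Nset G k, s(u, v) ≠ s(Sum.inl j, Sum.inr k)) : (Ograph G k).Adj u v :=
  Ograph_adj_iff.2 ⟨Or.inl ⟨huv, hne⟩, huv.ne⟩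

lemma Ograph_adj_of_mem_Nset {j : Fin h} (hj : j ∈ Nset G k) :
    (Ograph G k).Adj (Sum.inl j) (Sum.inl k) :=
  Ograph_adj_iff.2 ⟨Or.inr ⟨j, hj, rfl⟩, fun h' => hj.2 (Sum.inl_injective h')⟩

lemma Oweight_of_mem_Nset {j : Fin h} (hj : j ∈ Nset G k) :
    Oweight G w k s(Sum.inl j, Sum.inl k) = w s(Sum.inl j, Sum.inr k) := by
  have hex : ∃ l ∈ Nset G k,
      (s(Sum.inl j, Sum.inl k) : Sym2 (Fin h ⊕ Fin h)) = s(Sum.inl l, Sum.inl k) := ⟨j, hj, rfl⟩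
  have hspec := hex.choose_spec.2
  have heq : hex.choose = j := by simpa using (Sym2.congr_left.1 hspec).symm
  rw [Oweight, dif_pos hex, heq]

lemma WeightedExchange.not_adj_of_mem_Nset (hex : WeightedExchange G w) {j : Fin h}
    (hj : j ∈ Nset G k) : ¬ G.Adj (Sum.inl j) (Sum.inl k) := fun hadj =>
  (hex hadj.symm hj.1.symm).1.ne rfl

lemma WeightedExchange.Oweight_of_adj (hex : WeightedExchange G w) {u v : Fin h ⊕ Fin h}
    (huv : G.Adj u v) : Oweight G w k s(u, v) = w s(u, v) := by
  rw [Oweight, dif_neg]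
  rintro ⟨j, hj, heq⟩
  exact hex.not_adj_of_mem_Nset hj (by rwa [← SimpleGraph.mem_edgeSet, ← heq])

/-- The exchange property passes from a weighted graph to its modification at `k`. -/
lemma WeightedExchange.Ograph (hex : WeightedExchange G w)
    (hindep : IsIndepSet G (Set.range Sum.inr)) (hmatch : ∀ i, G.Adj (Sum.inl i) (Sum.inr i))
    (hle : ∀ i j, G.Adj (Sum.inl i) (Sum.inr j) → i ≤ j) :
    WeightedExchange (Ograph G k) (Oweight G w k) := by
  have hleaf : ∀ ⦃i z⦄, G.Adj (Sum.inr i) z → ∃ l, z = Sum.inl l := by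
    rintro i (l | l) hz
    · exact ⟨l, rfl⟩
    · exact (hindep ⟨i, rfl⟩ ⟨l, rfl⟩ hz.ne hz).elim
  intro i z z' hz hz'
  obtain ⟨hzO, -⟩ := Ograph_adj_iff.1 hz
  obtain ⟨hzO', -⟩ := Ograph_adj_iff.1 hz'
  obtain ⟨hz'G, hz'N⟩ : G.Adj (Sum.inr i) z' ∧
      ∀ j ∈ Nset G k, s(Sum.inr i, z') ≠ s(Sum.inl j, Sum.inr k) := by
    refine hzO'.resolve_right ?_
    rintro ⟨j, -, heq⟩
    simp at heq
  obtain ⟨l, rfl⟩ := hleaf hz'G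
  by_cases hik : i = k
  · subst hik
    have hli : l = i := by
      by_contra hli
      exact hz'N l ⟨hz'G.symm, hli⟩ Sym2.eq_swap
    subst hli
    refine ⟨hz.symm, (congrArg _ Sym2.eq_swap).le, ?_⟩
    rw [hex.Oweight_of_adj hz'G]
    rcases hzO with ⟨hzG, -⟩ | ⟨j, hj, heq⟩
    · rw [hex.Oweight_of_adj hzG.symm]
      exact (hex hzG hz'G).2.2
    · have hzj : z = Sum.inl j := by
        rw [Sym2.eq_swap] at heq
        exact Sym2.congr_left.1 heq
      subst hzj
      rw [Oweight_of_mem_Nset hj, Sym2.eq_swap (a := Sum.inl j),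
        Sym2.eq_swap (a := Sum.inr l) (b := Sum.inl l)]
      exact (hex (hmatch l) hj.1.symm).2.1
  · rcases hzO with ⟨hzG, hzN⟩ | ⟨j, hj, heq⟩
    · obtain ⟨hadj, h₁, h₂⟩ := hex hzG hz'G
      refine ⟨Ograph_adj_of_adj hadj fun j hj heq => ?_, ?_⟩
      · have hzk : z = Sum.inr k := by
          have : Sum.inr k ∈ s(z, Sum.inl l) := heq ▸ Sym2.mem_mk_right _ _
          simpa [eq_comm] using this
        subst hzk
        exact hzN i ⟨hzG, hik⟩ rfl
      · rw [hex.Oweight_of_adj hadj, hex.Oweight_of_adj hzG, hex.Oweight_of_adj hz'G]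
        exact ⟨h₁, h₂⟩
    · obtain ⟨rfl, rfl⟩ : i = j ∧ z = Sum.inl k := by
        rcases Sym2.eq_iff.1 heq with ⟨h₁, h₂⟩ | ⟨h₁, h₂⟩
        · exact ⟨Sum.inl_injective h₁, h₂⟩
        · exact (hik (Sum.inl_injective h₁)).elim
      obtain ⟨hadj, h₁, h₂⟩ := hex hj.1 hz'G
      have hl : l ∈ Nset G k := by
        refine ⟨hadj.symm, ?_⟩
        rintro rfl
        exact hik (le_antisymm (hle _ _ hj.1) (hle _ _ hz'G.symm))
      refine ⟨(Ograph_adj_of_mem_Nset hl).symm, ?_⟩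
      rw [Sym2.eq_swap, Oweight_of_mem_Nset hl, Oweight_of_mem_Nset hj, hex.Oweight_of_adj hz'G,
        Sym2.eq_swap]
      exact ⟨h₁, h₂⟩

end Ograph

/-- If `G` is a Cohen-Macaulay very well-covered graph with `2h` vertices labeled so that
conditions (*) and (**) hold, and `w` is an edge weight such that `I(G_w)` is unmixed,
then the edge-weighted edge ideal of `O_k(G_w)` is unmixed for every `k`. -/
theorem Ograph_weighted_unmixed {h : ℕ} (K : Type u) [Field K]
    (G : SimpleGraph (Fin h ⊕ Fin h)) (hvwc : IsVeryWellCovered G) (hstar : CondStar G)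
    (hstarstar : ∀ i j : Fin h, G.Adj (Sum.inl i) (Sum.inr j) → i ≤ j)
    (hCM : IsCohenMacaulayRing (MvPolynomial (Fin h ⊕ Fin h) K ⧸ edgeIdeal K G))
    (w : Sym2 (Fin h ⊕ Fin h) → ℕ) (hw : ∀ e ∈ G.edgeSet, 0 < w e)
    (hunm : IsUnmixedIdeal (weightedEdgeIdeal K G w)) :
    ∀ k : Fin h, IsUnmixedIdeal (weightedEdgeIdeal K (Ograph G k) (Oweight G w k)) := by
  intro k
  have hindep : IsIndepSet G (Set.range Sum.inr) := hstar.2.1.1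
  have hmatch := hstar.2.2
  have hex := weightedExchange_of_isUnmixedIdeal hindep hmatch hw hunm
  refine (hex.Ograph hindep hmatch hstarstar).isUnmixedIdeal fun i => ?_
  refine Ograph_adj_of_adj (hmatch i) fun j hj heq => hj.2 ?_
  rcases Sym2.eq_iff.1 heq with ⟨h₁, h₂⟩ | ⟨h₁, -⟩
  · rw [← Sum.inl_injective h₁, Sum.inr_injective h₂]
  · exact (Sum.inl_ne_inr h₁).elim
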